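/- Let p be an odd prime and let A₁, A₂ ∈ ℤ/pℤ be nonzero with A₁ ≠ A₂. Let L := {(a₁, a₂) ∈ ℤ² | a₁ • A₁ + a₂ • A₂ = 0 in ℤ/pℤ} and T := {(a₁, a₂) ∈ ℤ² | 0 ≤ a₁ < p and 0 ≤ a₂ < p}. Then the map (a₁, a₂) ↦ a₁ + a₂ is injective on L ∩ T, and the set D := {a₁ + a₂ | (a₁, a₂) ∈ L ∩ T, (a₁, a₂) ≠ (0,0)} of nonzero degrees satisfies: (i) D ⊆ {2, 3, …, 2p − 2}; (ii) if d ∈ D then 2p − d ∈ D; (iii) every nonzero residue class modulo p contains exactly one element of D, and p ∉ D; (iv) for every d ∈ D, no element of D is congruent to p modulo d. -/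

import Mathlib

/-- The lattice `{(a₁, a₂) ∈ ℤ² | a₁ • A₁ + a₂ • A₂ = 0}` as a subset of `ℤ²`. -/
def L12 (p : ℕ) (A₁ A₂ : ZMod p) : Set (Fin 2 → ℤ) :=
  {a | a 0 • A₁ + a 1 • A₂ = 0}

/-- The box `T = {(a₁, a₂) | 0 ≤ a₁ < p, 0 ≤ a₂ < p}`. -/
def T12 (p : ℕ) : Set (Fin 2 → ℤ) :=
  {a | 0 ≤ a 0 ∧ a 0 < (p : ℤ) ∧ 0 ≤ a 1 ∧ a 1 < (p : ℤ)}

/-- The set `D` of nonzero degrees of points of `L ∩ T`. -/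
def D12 (p : ℕ) (A₁ A₂ : ZMod p) : Set ℤ :=
  {d | ∃ a ∈ L12 p A₁ A₂ ∩ T12 p, a ≠ 0 ∧ a 0 + a 1 = d}

theorem mem_L12_iff {p : ℕ} {A₁ A₂ : ZMod p} {a : Fin 2 → ℤ} :
    a ∈ L12 p A₁ A₂ ↔ (a 0 : ZMod p) * A₁ + (a 1 : ZMod p) * A₂ = 0 := by
  simp [L12, zsmul_eq_mul]

/-- Two points of the lattice with degrees congruent mod `p` are congruent mod `p`, also after
scaling one of them. -/
theorem dvd_sub_mul_of_mem_L12 {p : ℕ} (hp : p.Prime) {A₁ A₂ : ZMod p} (hne : A₁ ≠ A₂)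
    {a b : Fin 2 → ℤ} (ha : a ∈ L12 p A₁ A₂) (hb : b ∈ L12 p A₁ A₂) (k : ℤ)
    (h : (p : ℤ) ∣ (b 0 + b 1) - k * (a 0 + a 1)) :
    (p : ℤ) ∣ b 0 - k * a 0 ∧ (p : ℤ) ∣ b 1 - k * a 1 := by
  have := Fact.mk hp
  rw [mem_L12_iff] at ha hb
  rw [← ZMod.intCast_zmod_eq_zero_iff_dvd] at h
  simp only [← ZMod.intCast_zmod_eq_zero_iff_dvd]
  push_cast at h ⊢
  have hsub : A₁ - A₂ ≠ 0 := sub_ne_zero.mpr hne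
  constructor
  · refine (mul_eq_zero.mp ?_).resolve_right hsub
    linear_combination hb - k * ha - A₂ * h
  · refine (mul_eq_zero.mp ?_).resolve_right hsub
    linear_combination -hb + k * ha + A₁ * h

theorem Int.eq_of_dvd_sub_of_mem_Ico {n x y : ℤ} (hx : 0 ≤ x) (hxn : x < n) (hy : 0 ≤ y)
    (hyn : y < n) (h : n ∣ x - y) : x = y := by
  have := Int.eq_zero_of_abs_lt_dvd h (by rw [abs_lt]; constructor <;> linarith)
  linarith

/-- Points of `L ∩ T` are determined by their degree mod `p`. -/
theorem eq_of_mem_L12_inter_T12 {p : ℕ} (hp : p.Prime) {A₁ A₂ : ZMod p} (hne : A₁ ≠ A₂)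
    {a b : Fin 2 → ℤ} (ha : a ∈ L12 p A₁ A₂ ∩ T12 p) (hb : b ∈ L12 p A₁ A₂ ∩ T12 p)
    (h : (p : ℤ) ∣ (a 0 + a 1) - (b 0 + b 1)) : a = b := by
  obtain ⟨ha, ha0, ha0', ha1, ha1'⟩ := ha
  obtain ⟨hb, hb0, hb0', hb1, hb1'⟩ := hb
  obtain ⟨h0, h1⟩ := dvd_sub_mul_of_mem_L12 hp hne hb ha 1 (by simpa using h)
  rw [one_mul] at h0 h1
  ext i
  fin_cases i
  · exact Int.eq_of_dvd_sub_of_mem_Ico ha0 ha0' hb0 hb0' h0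
  · exact Int.eq_of_dvd_sub_of_mem_Ico ha1 ha1' hb1 hb1' h1

/-- Nonzero points of `L ∩ T` have nonzero coordinates. -/
theorem pos_of_mem_L12_inter_T12 {p : ℕ} (hp : p.Prime) {A₁ A₂ : ZMod p}
    (h1 : A₁ ≠ 0) (h2 : A₂ ≠ 0) {a : Fin 2 → ℤ} (ha : a ∈ L12 p A₁ A₂ ∩ T12 p) (hne : a ≠ 0) :
    0 < a 0 ∧ 0 < a 1 := by
  have := Fact.mk hp
  obtain ⟨ha, ha0, ha0', ha1, ha1'⟩ := ha
  rw [mem_L12_iff] at ha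
  have key : a 0 = 0 ↔ a 1 = 0 := by
    constructor <;> intro h <;>
      simp only [h, Int.cast_zero, zero_mul, zero_add, add_zero, mul_eq_zero, h1, h2, or_false,
        ZMod.intCast_zmod_eq_zero_iff_dvd] at ha
    · exact Int.eq_zero_of_dvd_of_nonneg_of_lt ha1 ha1' ha
    · exact Int.eq_zero_of_dvd_of_nonneg_of_lt ha0 ha0' ha
  have : a 0 ≠ 0 := by
    intro h
    apply hne
    ext i
    fin_cases i
    · exact h
    · exact key.mp h
  have : a 1 ≠ 0 := fun h => this (key.mpr h)
  omega

/-- Let `p` be an odd prime and `A₁, A₂ ∈ ℤ/pℤ` nonzero and distinct. Then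
the degree map is injective on `L ∩ T`, and the set `D` of nonzero degrees satisfies:
(i) `D ⊆ {2, …, 2p−2}`; (ii) `D` is stable under `d ↦ 2p − d`; (iii) each nonzero residue class
mod `p` contains exactly one element of `D`, and `p ∉ D`; (iv) for `d ∈ D`, no element of `D`
is congruent to `p` mod `d`. -/
theorem stmt_12 (p : ℕ) (hp : p.Prime) (hp2 : p ≠ 2) (A₁ A₂ : ZMod p)
    (h1 : A₁ ≠ 0) (h2 : A₂ ≠ 0) (hne : A₁ ≠ A₂) :
    Set.InjOn (fun a : Fin 2 → ℤ => a 0 + a 1) (L12 p A₁ A₂ ∩ T12 p) ∧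
    (∀ d ∈ D12 p A₁ A₂, 2 ≤ d ∧ d ≤ 2 * (p : ℤ) - 2) ∧
    (∀ d ∈ D12 p A₁ A₂, 2 * (p : ℤ) - d ∈ D12 p A₁ A₂) ∧
    (∀ c : ZMod p, c ≠ 0 → ∃! d : ℤ, d ∈ D12 p A₁ A₂ ∧ (d : ZMod p) = c) ∧
    ((p : ℤ) ∉ D12 p A₁ A₂) ∧
    (∀ d ∈ D12 p A₁ A₂, ∀ e ∈ D12 p A₁ A₂, ¬ (e ≡ (p : ℤ) [ZMOD d])) := by
  have := Fact.mk hp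
  refine ⟨?_, ?_, ?_, ?_, ?_, ?_⟩
  · intro a ha b hb hab
    have hab : a 0 + a 1 = b 0 + b 1 := hab
    exact eq_of_mem_L12_inter_T12 hp hne ha hb (by simp [hab])
  · rintro d ⟨a, ha, ha0, rfl⟩
    obtain ⟨hpos0, hpos1⟩ := pos_of_mem_L12_inter_T12 hp h1 h2 ha ha0
    obtain ⟨-, -, hlt0, -, hlt1⟩ := ha
    omega
  · rintro d ⟨a, ha, ha0, rfl⟩
    obtain ⟨hpos0, hpos1⟩ := pos_of_mem_L12_inter_T12 hp h1 h2 ha ha0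
    obtain ⟨haL, -, hlt0, -, hlt1⟩ := ha
    refine ⟨![p - a 0, p - a 1], ⟨?_, ?_⟩, ?_, ?_⟩
    · rw [mem_L12_iff] at haL ⊢
      simp only [Matrix.cons_val_zero, Matrix.cons_val_one, Int.cast_sub, Int.cast_natCast,
        CharP.cast_eq_zero]
      linear_combination -haL
    · simp only [T12, Set.mem_ofPred_eq, Matrix.cons_val_zero, Matrix.cons_val_one]
      omega
    · intro h
      have := congrFun h 0
      simp only [Matrix.cons_val_zero, Pi.zero_apply] at this
      omega
    · simp only [Matrix.cons_val_zero, Matrix.cons_val_one]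
      ring
  · intro c hc
    have hsub : A₁ - A₂ ≠ 0 := sub_ne_zero.mpr hne
    have hcast (x : ZMod p) : ((x.val : ℤ) : ZMod p) = x := by simp
    have hlt (x : ZMod p) : (x.val : ℤ) < p := by exact_mod_cast x.val_lt
    set x : ZMod p := -c * A₂ / (A₁ - A₂) with hx
    set y : ZMod p := c * A₁ / (A₁ - A₂) with hy
    have hxy : x + y = c := by rw [hx, hy]; field_simp; ring
    have hxA : x * A₁ + y * A₂ = 0 := by rw [hx, hy]; field_simp; ring
    refine ⟨x.val + y.val, ⟨⟨![x.val, y.val], ⟨?_, ?_⟩, ?_, ?_⟩, ?_⟩, ?_⟩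
    · rw [mem_L12_iff]
      simpa only [Matrix.cons_val_zero, Matrix.cons_val_one, hcast] using hxA
    · exact ⟨Int.natCast_nonneg _, hlt x, Int.natCast_nonneg _, hlt y⟩
    · intro h
      have hx0 : (x.val : ℤ) = 0 := congrFun h 0
      have hy0 : (y.val : ℤ) = 0 := congrFun h 1
      apply hc
      rw [← hxy, ← hcast x, ← hcast y, hx0, hy0]
      simp
    · rfl
    · rw [Int.cast_add, hcast, hcast, hxy]
    · rintro d ⟨⟨a, ha, -, rfl⟩, hac⟩
      have hab : a = ![(x.val : ℤ), (y.val : ℤ)] := by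
        refine eq_of_mem_L12_inter_T12 hp hne ha ⟨?_, ?_⟩ ?_
        · rw [mem_L12_iff]
          simpa only [Matrix.cons_val_zero, Matrix.cons_val_one, hcast] using hxA
        · exact ⟨Int.natCast_nonneg _, hlt x, Int.natCast_nonneg _, hlt y⟩
        · rw [← ZMod.intCast_zmod_eq_zero_iff_dvd, Int.cast_sub, hac]
          simp only [Matrix.cons_val_zero, Matrix.cons_val_one, Int.cast_add, hcast, hxy, sub_self]
      rw [hab]
      rfl
  · rintro ⟨a, ha, ha0, hap⟩
    have hp0 : (0 : ℤ) < p := by exact_mod_cast hp.pos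
    refine ha0 (eq_of_mem_L12_inter_T12 hp hne ha ⟨?_, ?_⟩ ?_)
    · simp [mem_L12_iff]
    · simp [T12, hp.pos]
    · simp [hap]
  · rintro d ⟨a, ha, ha0, rfl⟩ e ⟨b, hb, hb0, rfl⟩ hmod
    obtain ⟨hapos0, hapos1⟩ := pos_of_mem_L12_inter_T12 hp h1 h2 ha ha0
    obtain ⟨hbpos0, hbpos1⟩ := pos_of_mem_L12_inter_T12 hp h1 h2 hb hb0
    obtain ⟨haL, -⟩ := ha
    obtain ⟨hbL, -, hblt0, -, hblt1⟩ := hb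
    have hp0 : (0 : ℤ) < p := by exact_mod_cast hp.pos
    obtain ⟨k, hk⟩ := hmod.symm.dvd
    have hdeg : (b 0 + b 1) - k * (a 0 + a 1) = p := by linear_combination hk
    obtain ⟨⟨u, hu⟩, ⟨v, hv⟩⟩ := dvd_sub_mul_of_mem_L12 hp hne haL hbL k (by rw [hdeg])
    have huv : u + v = 1 := by
      apply mul_left_cancel₀ hp0.ne'
      linear_combination hdeg - hu - hv
    rcases le_or_gt 0 k with hk0 | hk0
    · have : 1 ≤ u ∨ 1 ≤ v := by omega
      rcases this with h | h <;> nlinarith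
    · have : u ≤ 0 ∨ v ≤ 0 := by omega
      rcases this with h | h <;> nlinarith
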